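/- Let H be a subgroup and N a normal subgroup of a finite group G. Then β(G) ≤ β(N) · β(G/N) and β(G) ≤ |G : H| · β(H). -/

import Mathlib

/-!  Definition of the Noether number `β(G)` of a group `G`, over the field `ℂ`
(of characteristic 0).  A finite-dimensional `ℂG`-module is (up to isomorphism)
given by a representation `ρ : Representation ℂ G (Fin n → ℂ)`; the algebra of
polynomial invariants is realised inside `MvPolynomial (Fin n) ℂ` as the
common equalizer of the substitution maps induced by the group elements. -/

/-- The algebra endomorphism of the polynomial ring induced by the linear action of
`g : G` on the underlying space (substitution of the variables by linear forms). -/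
noncomputable def Representation.polySubst {G : Type*} [Group G] {n : ℕ}
    (ρ : Representation ℂ G (Fin n → ℂ)) (g : G) :
    MvPolynomial (Fin n) ℂ →ₐ[ℂ] MvPolynomial (Fin n) ℂ :=
  MvPolynomial.aeval fun i =>
    ∑ j, MvPolynomial.C (LinearMap.toMatrix' (ρ g) i j) * MvPolynomial.X j

/-- The subalgebra of `G`-invariant polynomials. -/
noncomputable def Representation.invariantAlgebra {G : Type*} [Group G] {n : ℕ}
    (ρ : Representation ℂ G (Fin n → ℂ)) : Subalgebra ℂ (MvPolynomial (Fin n) ℂ) :=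
  ⨅ g : G, AlgHom.equalizer (ρ.polySubst g) (AlgHom.id ℂ (MvPolynomial (Fin n) ℂ))

/-- The invariant algebra is generated by its elements of (total) degree at most `d`. -/
def Representation.InvariantsGeneratedInDegree {G : Type*} [Group G] {n : ℕ}
    (ρ : Representation ℂ G (Fin n → ℂ)) (d : ℕ) : Prop :=
  Algebra.adjoin ℂ {f : MvPolynomial (Fin n) ℂ | f ∈ ρ.invariantAlgebra ∧ f.totalDegree ≤ d}
    = ρ.invariantAlgebra

/-- The Noether number `β(G)`: the smallest degree bound `d` such that for every
finite-dimensional `ℂG`-module the algebra of polynomial invariants is generated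
by its elements of degree at most `d`.  (Equivalently, the maximum over all
finite-dimensional modules `V` of the minimal generating degree `β(G,V)`.) -/
noncomputable def noetherNumber (G : Type*) [Group G] : ℕ :=
  sInf {d : ℕ | ∀ (n : ℕ) (ρ : Representation ℂ G (Fin n → ℂ)),
    ρ.InvariantsGeneratedInDegree d}

/-- The Noether index `n(G) = |G| / β(G)`, as a real number. -/
noncomputable def noetherIndex (G : Type*) [Group G] : ℝ :=
  (Nat.card G : ℝ) / (noetherNumber G : ℝ)

namespace MvPolynomial

theorem totalDegree_aeval_le {R σ τ : Type*} [CommSemiring R] (w : σ → MvPolynomial τ R) {d : ℕ}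
    (hw : ∀ i, (w i).totalDegree ≤ d) (p : MvPolynomial σ R) :
    (aeval w p).totalDegree ≤ d * p.totalDegree := by
  rw [aeval_def, eval₂_eq]
  refine totalDegree_finsetSum_le fun s hs => ?_
  rw [algebraMap_eq]
  refine (totalDegree_mul _ _).trans ?_
  rw [totalDegree_C, zero_add]
  refine (totalDegree_finsetProd _ _).trans ?_
  calc ∑ i ∈ s.support, (w i ^ s i).totalDegree ≤ ∑ i ∈ s.support, d * s i :=
        Finset.sum_le_sum fun i _ => (totalDegree_pow _ _).trans (by
          rw [mul_comm]; exact Nat.mul_le_mul_right _ (hw i))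
    _ = d * s.sum fun _ e => e := by rw [← Finset.mul_sum]; rfl
    _ ≤ d * p.totalDegree := Nat.mul_le_mul_left _ (le_totalDegree hs)

end MvPolynomial

namespace Representation

open MvPolynomial

variable {G : Type*} [Group G] {n : ℕ} (ρ : Representation ℂ G (Fin n → ℂ))

@[simp]
theorem polySubst_X (g : G) (i : Fin n) :
    ρ.polySubst g (X i) = ∑ j, C (LinearMap.toMatrix' (ρ g) i j) * X j :=
  aeval_X _ _

theorem polySubst_one : ρ.polySubst 1 = AlgHom.id ℂ _ := by
  refine MvPolynomial.algHom_ext fun i => ?_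
  rw [polySubst_X, map_one, Module.End.one_eq_id, LinearMap.toMatrix'_id]
  simp [Matrix.one_apply]

theorem polySubst_mul (g h : G) : ρ.polySubst (g * h) = (ρ.polySubst h).comp (ρ.polySubst g) := by
  refine MvPolynomial.algHom_ext fun i => ?_
  simp only [polySubst_X, map_mul, LinearMap.toMatrix'_mul, Matrix.mul_apply, AlgHom.comp_apply,
    map_sum, algHom_C, algebraMap_eq, Finset.sum_mul, Finset.mul_sum, mul_assoc]
  exact Finset.sum_comm

theorem polySubst_mul_apply (g h : G) (f : MvPolynomial (Fin n) ℂ) :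
    ρ.polySubst (g * h) f = ρ.polySubst h (ρ.polySubst g f) := by
  rw [polySubst_mul, AlgHom.comp_apply]

theorem totalDegree_polySubst_le (g : G) (f : MvPolynomial (Fin n) ℂ) :
    (ρ.polySubst g f).totalDegree ≤ f.totalDegree := by
  refine (totalDegree_aeval_le _ (d := 1) (fun i => ?_) f).trans (one_mul _).le
  refine totalDegree_finsetSum_le fun j _ => (totalDegree_mul _ _).trans ?_
  rw [totalDegree_C, totalDegree_X]

theorem mem_invariantAlgebra {f : MvPolynomial (Fin n) ℂ} :
    f ∈ ρ.invariantAlgebra ↔ ∀ g, ρ.polySubst g f = f := by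
  simp [invariantAlgebra, Algebra.mem_iInf, AlgHom.mem_equalizer]

theorem adjoin_invariants_le (d : ℕ) :
    Algebra.adjoin ℂ {f : MvPolynomial (Fin n) ℂ | f ∈ ρ.invariantAlgebra ∧ f.totalDegree ≤ d}
      ≤ ρ.invariantAlgebra :=
  Algebra.adjoin_le fun _ hf => hf.1

/-- The relative invariants of a subgroup contain those of the whole group. -/
theorem invariantAlgebra_le_comp_subtype (H : Subgroup G) :
    ρ.invariantAlgebra ≤ invariantAlgebra (ρ.comp H.subtype) := fun _ hf =>
  (mem_invariantAlgebra _).2 fun h => (ρ.mem_invariantAlgebra).1 hf h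

theorem polySubst_of_mem_comp_subtype {H : Subgroup G} {f : MvPolynomial (Fin n) ℂ}
    (hf : f ∈ invariantAlgebra (ρ.comp H.subtype)) {h : G} (hh : h ∈ H) : ρ.polySubst h f = f :=
  (mem_invariantAlgebra _).1 hf ⟨h, hh⟩

section Transfer

variable [Fintype G]

/-- The transfer map `f ↦ ∑ g, g • f`, that is, `|G|` times the Reynolds operator. -/
noncomputable def transfer : MvPolynomial (Fin n) ℂ →ₗ[ℂ] MvPolynomial (Fin n) ℂ :=
  ∑ g, (ρ.polySubst g).toLinearMap

theorem transfer_apply (f : MvPolynomial (Fin n) ℂ) : ρ.transfer f = ∑ g, ρ.polySubst g f := by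
  simp [transfer]

theorem transfer_mem (f : MvPolynomial (Fin n) ℂ) : ρ.transfer f ∈ ρ.invariantAlgebra := by
  refine ρ.mem_invariantAlgebra.2 fun h => ?_
  simp only [transfer_apply, map_sum, ← polySubst_mul_apply]
  exact Fintype.sum_equiv (Equiv.mulRight h) _ _ fun _ => rfl

theorem transfer_mul {b : MvPolynomial (Fin n) ℂ} (hb : b ∈ ρ.invariantAlgebra)
    (f : MvPolynomial (Fin n) ℂ) : ρ.transfer (b * f) = b * ρ.transfer f := by
  simp only [transfer_apply, map_mul, ρ.mem_invariantAlgebra.1 hb, Finset.mul_sum]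

theorem transfer_of_mem {f : MvPolynomial (Fin n) ℂ} (hf : f ∈ ρ.invariantAlgebra) :
    ρ.transfer f = (Fintype.card G : ℂ) • f := by
  simp [transfer_apply, ρ.mem_invariantAlgebra.1 hf, Nat.cast_smul_eq_nsmul]

theorem eq_smul_transfer {f : MvPolynomial (Fin n) ℂ} (hf : f ∈ ρ.invariantAlgebra) :
    f = (Fintype.card G : ℂ)⁻¹ • ρ.transfer f := by
  rw [ρ.transfer_of_mem hf, inv_smul_smul₀ (Nat.cast_ne_zero.2 Fintype.card_ne_zero)]

theorem totalDegree_transfer_le (f : MvPolynomial (Fin n) ℂ) :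
    (ρ.transfer f).totalDegree ≤ f.totalDegree := by
  rw [transfer_apply]
  exact totalDegree_finsetSum_le fun g _ => ρ.totalDegree_polySubst_le g f

/-- Benson's identity relative to a subgroup `H`: summing over `g ∈ G` the vanishing products of
`g • (c • u c) - u c` over the cosets `c` of `H`. -/
theorem sum_transfer_mul_prod_eq_zero (H : Subgroup G) [Fintype (G ⧸ H)]
    [DecidableEq (G ⧸ H)] (u : G ⧸ H → MvPolynomial (Fin n) ℂ)
    (hu : ∀ c, u c ∈ invariantAlgebra (ρ.comp H.subtype)) :
    ∑ t : Finset (G ⧸ H), ρ.transfer (∏ c ∈ t, ρ.polySubst c.out⁻¹ (u c)) * ∏ c ∈ tᶜ, -u c = 0 := by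
  have vanish (g : G) : ∏ c, (ρ.polySubst g (ρ.polySubst c.out⁻¹ (u c)) + -u c) = 0 := by
    refine Finset.prod_eq_zero (Finset.mem_univ (g : G ⧸ H)) ?_
    rw [← polySubst_mul_apply, ρ.polySubst_of_mem_comp_subtype (hu _), add_neg_cancel]
    exact QuotientGroup.eq.1 (QuotientGroup.out_eq' _)
  simp only [transfer_apply, Finset.sum_mul]
  rw [Finset.sum_comm]
  refine Finset.sum_eq_zero fun g _ => ?_
  rw [← vanish g, Fintype.prod_add]
  simp only [map_prod]

/-- The transfer of a product of relative invariants of degree at most `d` is a polynomial in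
invariants of degree at most `|G : H| * d`. -/
theorem transfer_prod_mem_adjoin (H : Subgroup G) {d : ℕ} {ι : Type*} [DecidableEq ι]
    (u : ι → MvPolynomial (Fin n) ℂ)
    (hu : ∀ i, u i ∈ invariantAlgebra (ρ.comp H.subtype)) (hd : ∀ i, (u i).totalDegree ≤ d)
    (s : Finset ι) :
    ρ.transfer (∏ i ∈ s, u i) ∈ Algebra.adjoin ℂ
      {f : MvPolynomial (Fin n) ℂ | f ∈ ρ.invariantAlgebra ∧ f.totalDegree ≤ H.index * d} := by
  classical
  have : Fintype (G ⧸ H) := Fintype.ofFinite _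
  have hindex : H.index = Fintype.card (G ⧸ H) := Nat.card_eq_fintype_card
  induction s using Finset.strongInduction with
  | H s ih =>
  set B := Algebra.adjoin ℂ
    {f : MvPolynomial (Fin n) ℂ | f ∈ ρ.invariantAlgebra ∧ f.totalDegree ≤ H.index * d}
  rcases le_total s.card H.index with hs | hs
  · refine Algebra.subset_adjoin ⟨ρ.transfer_mem _, (ρ.totalDegree_transfer_le _).trans ?_⟩
    refine (totalDegree_finsetProd _ _).trans
      ((Finset.sum_le_card_nsmul _ _ d fun i _ => hd i).trans ?_)
    exact Nat.mul_le_mul_right d hs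
  · obtain ⟨e⟩ : Nonempty (G ⧸ H ↪ s) :=
      Function.Embedding.nonempty_of_card_le (by rwa [Fintype.card_coe, ← hindex])
    let e' : G ⧸ H ↪ ι := e.trans (Function.Embedding.subtype _)
    have he' (t : Finset (G ⧸ H)) : t.map e' ⊆ s := fun i hi => by
      obtain ⟨c, -, rfl⟩ := Finset.mem_map.1 hi
      exact (e c).2
    have hsplit (t : Finset (G ⧸ H)) : (∏ c ∈ tᶜ, u (e' c)) * ∏ i ∈ s \ Finset.univ.map e', u i
        = ∏ i ∈ s \ t.map e', u i := by
      rw [← Finset.prod_map tᶜ e' u, ← Finset.prod_union]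
      · congr 1
        ext i
        have := he' Finset.univ
        simp only [Finset.subset_iff, Finset.mem_map, Finset.mem_univ, true_and] at this
        simp only [Finset.mem_union, Finset.mem_map, Finset.mem_sdiff, Finset.mem_compl,
          Finset.mem_univ, true_and]
        grind [e'.injective.eq_iff]
      · refine Finset.disjoint_left.2 fun i hi hi' => (Finset.mem_sdiff.1 hi').2 ?_
        exact Finset.map_subset_map.2 (Finset.subset_univ _) hi
    let b (t : Finset (G ⧸ H)) := ρ.transfer (∏ c ∈ t, ρ.polySubst c.out⁻¹ (u (e' c)))
    have hb (t : Finset (G ⧸ H)) : b t ∈ B := by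
      refine Algebra.subset_adjoin ⟨ρ.transfer_mem _, (ρ.totalDegree_transfer_le _).trans ?_⟩
      refine (totalDegree_finsetProd _ _).trans ((Finset.sum_le_card_nsmul _ _ d fun c _ =>
        (ρ.totalDegree_polySubst_le _ _).trans (hd _)).trans ?_)
      rw [hindex]
      exact Nat.mul_le_mul_right d (Finset.card_le_univ t)
    have key : ∑ t : Finset (G ⧸ H),
        (-1) ^ tᶜ.card * (b t * ρ.transfer (∏ i ∈ s \ t.map e', u i)) = 0 := by
      have h0 := ρ.sum_transfer_mul_prod_eq_zero H (fun c => u (e' c)) fun c => hu _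
      have h1 := congrArg
        (fun p => ρ.transfer (p * ∏ i ∈ s \ Finset.univ.map e', u i)) h0
      simp only [zero_mul, map_zero, Finset.sum_mul, map_sum] at h1
      rw [← h1]
      refine Finset.sum_congr rfl fun t _ => ?_
      rw [Finset.prod_neg, mul_assoc, mul_assoc, hsplit, ρ.transfer_mul (ρ.transfer_mem _),
        ρ.transfer_mul (pow_mem (neg_mem (one_mem _)) _), mul_left_comm]
    rw [← Finset.add_sum_erase _ _ (Finset.mem_univ ∅)] at key
    have hb0 : b ∅ = C (Fintype.card G : ℂ) := by simp [b, transfer_apply]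
    have hcard : (Fintype.card G : ℂ) ≠ 0 := Nat.cast_ne_zero.2 Fintype.card_ne_zero
    rw [hb0, Finset.map_empty, Finset.sdiff_empty, add_eq_zero_iff_eq_neg] at key
    have hB : C (Fintype.card G : ℂ) * ρ.transfer (∏ i ∈ s, u i) ∈ B := by
      have hpow (k : ℕ) : ((-1) ^ k : MvPolynomial (Fin n) ℂ) ∈ B :=
        pow_mem (neg_mem (one_mem _)) _
      have h2 := congrArg
        (fun p => (-1) ^ (∅ᶜ : Finset (G ⧸ H)).card * p) key
      simp only [← mul_assoc, ← pow_add, Even.neg_one_pow (Even.add_self _), one_mul] at h2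
      rw [h2]
      refine mul_mem (hpow _) (neg_mem (sum_mem fun t ht => ?_))
      refine mul_mem (mul_mem (hpow _) (hb t)) (ih _ ?_)
      refine Finset.sdiff_ssubset (he' t) ?_
      exact (Finset.map_nonempty).2 (Finset.nonempty_iff_ne_empty.2 (Finset.ne_of_mem_erase ht))
    have := B.smul_mem hB (Fintype.card G : ℂ)⁻¹
    rwa [← smul_eq_C_mul, inv_smul_smul₀ hcard] at this

end Transfer

theorem InvariantsGeneratedInDegree.of_subgroup [Finite G] (H : Subgroup G) {d : ℕ}
    (hd : InvariantsGeneratedInDegree (ρ.comp H.subtype) d) :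
    ρ.InvariantsGeneratedInDegree (H.index * d) := by
  classical
  have : Fintype G := Fintype.ofFinite G
  refine le_antisymm (ρ.adjoin_invariants_le _) fun f hf => ?_
  have hspan := ρ.invariantAlgebra_le_comp_subtype H hf
  rw [← hd, ← Subalgebra.mem_toSubmodule, Algebra.adjoin_eq_span] at hspan
  rw [ρ.eq_smul_transfer hf]
  refine Subalgebra.smul_mem _ ?_ _
  clear hf
  induction hspan using Submodule.span_induction with
  | zero => simp
  | add x y _ _ hx hy => rw [map_add]; exact add_mem hx hy
  | smul a x _ hx => rw [map_smul]; exact Subalgebra.smul_mem _ hx _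
  | mem x hx =>
    obtain ⟨l, hl, rfl⟩ := Submonoid.exists_list_of_mem_closure hx
    rw [← Fin.prod_univ_getElem]
    exact ρ.transfer_prod_mem_adjoin H (fun i : Fin l.length => l[i.1])
      (fun i => (hl _ (List.getElem_mem _)).1) (fun i => (hl _ (List.getElem_mem _)).2) _

/-- The space of relative invariants of `N` of degree at most `d`. -/
noncomputable def boundedInvariants (N : Subgroup G) (d : ℕ) :
    Submodule ℂ (MvPolynomial (Fin n) ℂ) :=
  Subalgebra.toSubmodule (invariantAlgebra (ρ.comp N.subtype)) ⊓ restrictTotalDegree (Fin n) ℂ d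

theorem mem_boundedInvariants {N : Subgroup G} {d : ℕ} {f : MvPolynomial (Fin n) ℂ} :
    f ∈ ρ.boundedInvariants N d ↔
      f ∈ invariantAlgebra (ρ.comp N.subtype) ∧ f.totalDegree ≤ d := by
  rw [boundedInvariants, Submodule.mem_inf, Subalgebra.mem_toSubmodule, mem_restrictTotalDegree]

instance (N : Subgroup G) (d : ℕ) : FiniteDimensional ℂ (ρ.boundedInvariants N d) :=
  Submodule.finiteDimensional_of_le (S₂ := restrictTotalDegree (Fin n) ℂ d) inf_le_right

theorem polySubst_mem_boundedInvariants {N : Subgroup G} [hN : N.Normal] {d : ℕ} (g : G)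
    {f : MvPolynomial (Fin n) ℂ} (hf : f ∈ ρ.boundedInvariants N d) :
    ρ.polySubst g f ∈ ρ.boundedInvariants N d := by
  rw [mem_boundedInvariants] at hf ⊢
  refine ⟨(mem_invariantAlgebra _).2 fun h => ?_, (ρ.totalDegree_polySubst_le g f).trans hf.2⟩
  change ρ.polySubst (h : G) _ = _
  have hconj : g * h = (g * h * g⁻¹) * g := by group
  rw [← polySubst_mul_apply, hconj, polySubst_mul_apply,
    ρ.polySubst_of_mem_comp_subtype hf.1 (hN.conj_mem _ h.2 g)]

/-- Substitution by `g` on the relative invariants of `N` of degree at most `d`. -/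
noncomputable def boundedSubst (N : Subgroup G) [N.Normal] (d : ℕ) (g : G) :
    ρ.boundedInvariants N d →ₗ[ℂ] ρ.boundedInvariants N d :=
  (ρ.polySubst g).toLinearMap.restrict fun _ hf => ρ.polySubst_mem_boundedInvariants g hf

/-- The representation of `G ⧸ N` whose coordinate functions are a basis of the relative
invariants of `N` of degree at most `d`. -/
noncomputable def quotientRep (N : Subgroup G) [N.Normal] (d : ℕ) :
    Representation ℂ (G ⧸ N) (Fin (Module.finrank ℂ (ρ.boundedInvariants N d)) → ℂ) :=
  QuotientGroup.lift N
    { toFun g := Matrix.toLin' (LinearMap.toMatrix (Module.finBasis ℂ (ρ.boundedInvariants N d))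
        (Module.finBasis ℂ (ρ.boundedInvariants N d)) (ρ.boundedSubst N d g)).transpose
      map_one' := by
        have : ρ.boundedSubst N d 1 = LinearMap.id := by
          ext f : 2
          simp [boundedSubst, polySubst_one]
        rw [this, LinearMap.toMatrix_id, Matrix.transpose_one, Matrix.toLin'_one]
        rfl
      map_mul' g h := by
        have : ρ.boundedSubst N d (g * h) = ρ.boundedSubst N d h ∘ₗ ρ.boundedSubst N d g :=
          LinearMap.ext fun f => Subtype.ext (ρ.polySubst_mul_apply g h f)
        rw [this, LinearMap.toMatrix_comp _ (Module.finBasis ℂ (ρ.boundedInvariants N d)),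
          Matrix.transpose_mul, Matrix.toLin'_mul]
        rfl }
    fun h hh => by
      have : ρ.boundedSubst N d h = LinearMap.id :=
        LinearMap.ext fun f => Subtype.ext
          (ρ.polySubst_of_mem_comp_subtype (ρ.mem_boundedInvariants.1 f.2).1 hh)
      simp only [MonoidHom.mem_ker, MonoidHom.coe_mk, OneHom.coe_mk]
      rw [this, LinearMap.toMatrix_id, Matrix.transpose_one, Matrix.toLin'_one]
      rfl

/-- Evaluation of polynomials at a basis of the relative invariants of degree at most `d`. -/
noncomputable def quotientEval (N : Subgroup G) (d : ℕ) :
    MvPolynomial (Fin (Module.finrank ℂ (ρ.boundedInvariants N d))) ℂ →ₐ[ℂ]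
      MvPolynomial (Fin n) ℂ :=
  aeval fun i => (Module.finBasis ℂ (ρ.boundedInvariants N d) i : MvPolynomial (Fin n) ℂ)

theorem quotientEval_polySubst (N : Subgroup G) [N.Normal] (d : ℕ) (g : G)
    (p : MvPolynomial (Fin (Module.finrank ℂ (ρ.boundedInvariants N d))) ℂ) :
    ρ.quotientEval N d ((ρ.quotientRep N d).polySubst (g : G ⧸ N) p) =
      ρ.polySubst g (ρ.quotientEval N d p) := by
  suffices (ρ.quotientEval N d).comp ((ρ.quotientRep N d).polySubst (g : G ⧸ N)) =
      (ρ.polySubst g).comp (ρ.quotientEval N d) from DFunLike.congr_fun this p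
  refine MvPolynomial.algHom_ext fun i => ?_
  have hM : LinearMap.toMatrix' (ρ.quotientRep N d (g : G ⧸ N)) =
      (LinearMap.toMatrix (Module.finBasis ℂ (ρ.boundedInvariants N d))
        (Module.finBasis ℂ (ρ.boundedInvariants N d)) (ρ.boundedSubst N d g)).transpose :=
    LinearMap.toMatrix'_toLin' _
  have hsum := congrArg Subtype.val ((Module.finBasis ℂ (ρ.boundedInvariants N d)).sum_repr
    (ρ.boundedSubst N d g (Module.finBasis ℂ (ρ.boundedInvariants N d) i)))
  simp only [AddSubmonoidClass.coe_finsetSum, Submodule.coe_smul] at hsum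
  simp only [AlgHom.comp_apply, polySubst_X, hM, map_sum, map_mul, algHom_C, quotientEval, aeval_X,
    Matrix.transpose_apply, LinearMap.toMatrix_apply, ← Algebra.smul_def]
  exact hsum

theorem InvariantsGeneratedInDegree.of_quotient [Finite G] (N : Subgroup G) [N.Normal] {d e : ℕ}
    (hd : InvariantsGeneratedInDegree (ρ.comp N.subtype) d)
    (he : InvariantsGeneratedInDegree (ρ.quotientRep N d) e) :
    ρ.InvariantsGeneratedInDegree (d * e) := by
  have : Fintype (G ⧸ N) := Fintype.ofFinite _
  refine le_antisymm (ρ.adjoin_invariants_le _) fun f hf => ?_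
  have hrange : f ∈ (ρ.quotientEval N d).range := by
    have hfN := ρ.invariantAlgebra_le_comp_subtype N hf
    rw [← hd] at hfN
    refine Algebra.adjoin_le (fun w hw => ?_) hfN
    have hsum := congrArg Subtype.val ((Module.finBasis ℂ (ρ.boundedInvariants N d)).sum_repr
      ⟨w, ρ.mem_boundedInvariants.2 hw⟩)
    simp only [AddSubmonoidClass.coe_finsetSum, Submodule.coe_smul] at hsum
    rw [← hsum]
    exact sum_mem fun i _ => Subalgebra.smul_mem _ (AlgHom.mem_range _ |>.2 ⟨X i, aeval_X _ _⟩) _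
  obtain ⟨p, hp⟩ := hrange
  replace hp : ρ.quotientEval N d p = f := hp
  have htransfer : ρ.quotientEval N d ((ρ.quotientRep N d).transfer p) =
      (Fintype.card (G ⧸ N) : ℂ) • f := by
    rw [transfer_apply, map_sum, Finset.sum_congr rfl fun c _ => ?_, Finset.sum_const,
      Finset.card_univ, Nat.cast_smul_eq_nsmul]
    obtain ⟨g, rfl⟩ := QuotientGroup.mk_surjective c
    rw [quotientEval_polySubst, hp, ρ.mem_invariantAlgebra.1 hf]
  have hmem := (ρ.quotientRep N d).transfer_mem p
  rw [← he] at hmem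
  have hmap := Subalgebra.mem_map.2 ⟨_, hmem, htransfer⟩
  rw [AlgHom.map_adjoin] at hmap
  have hcard : (Fintype.card (G ⧸ N) : ℂ) ≠ 0 := Nat.cast_ne_zero.2 Fintype.card_ne_zero
  rw [← inv_smul_smul₀ hcard f]
  refine Subalgebra.smul_mem _ (Algebra.adjoin_mono ?_ hmap) _
  rintro _ ⟨q, ⟨hq, hqe⟩, rfl⟩
  refine ⟨ρ.mem_invariantAlgebra.2 fun g => ?_, ?_⟩
  · rw [← quotientEval_polySubst, (mem_invariantAlgebra _).1 hq]
  · refine (totalDegree_aeval_le _ (fun i => (ρ.mem_boundedInvariants.1 (Subtype.mem _)).2) q).trans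
      ?_
    exact Nat.mul_le_mul_left d hqe

theorem invariantsGeneratedInDegree_one [Subsingleton G] : ρ.InvariantsGeneratedInDegree 1 := by
  refine le_antisymm (ρ.adjoin_invariants_le _) (le_top.trans ?_)
  rw [← MvPolynomial.adjoin_range_X]
  refine Algebra.adjoin_mono ?_
  rintro _ ⟨i, rfl⟩
  refine ⟨ρ.mem_invariantAlgebra.2 fun g => ?_, (totalDegree_X i).le⟩
  rw [Subsingleton.elim g 1, polySubst_one, AlgHom.id_apply]

end Representation

/-- Noether's bound makes the Noether number of a finite group an attained degree bound. -/
theorem invariantsGeneratedInDegree_noetherNumber {G : Type*} [Group G] [Finite G] {n : ℕ}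
    (ρ : Representation ℂ G (Fin n → ℂ)) :
    ρ.InvariantsGeneratedInDegree (noetherNumber G) := by
  have hne : {d : ℕ | ∀ (n : ℕ) (ρ : Representation ℂ G (Fin n → ℂ)),
      ρ.InvariantsGeneratedInDegree d}.Nonempty :=
    ⟨(⊥ : Subgroup G).index * 1, fun _ ρ => .of_subgroup ρ ⊥
      (Representation.invariantsGeneratedInDegree_one _)⟩
  exact Nat.sInf_mem hne n ρ

/-- **Lemma (Schmid, Sezer).**  For a subgroup `H` and a normal subgroup `N` of a
finite group `G` we have `β(G) ≤ β(N)·β(G/N)` and `β(G) ≤ |G:H|·β(H)`. -/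
theorem noetherNumber_le_mul_of_subgroup_and_quotient
    (G : Type) [Group G] [Finite G] (H N : Subgroup G) (hN : N.Normal) :
    noetherNumber G ≤ noetherNumber N * noetherNumber (G ⧸ N) ∧
    noetherNumber G ≤ H.index * noetherNumber H := by
  refine ⟨Nat.sInf_le fun n ρ => ?_, Nat.sInf_le fun n ρ => ?_⟩
  · exact .of_quotient ρ N (invariantsGeneratedInDegree_noetherNumber _)
      (invariantsGeneratedInDegree_noetherNumber _)
  · exact .of_subgroup ρ H (invariantsGeneratedInDegree_noetherNumber _)
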